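/- arXiv:1802.07953 — 5 statements merged into one kernel-verified Lean document; each statement's English description precedes it below -/
import Mathlib

section
/- Let c ∈ ℝ. Consider the connection on ℝ² with constant Christoffel symbols Γ_{12}^1 = Γ_{21}^1 = 1, Γ_{22}^1 = c, Γ_{22}^2 = 2 and all other Γ_{ij}^k = 0 (the Type A model M₄^c, whose symmetric Ricci tensor is ρ_s = dx²⊗dx²). The set of smooth f : ℝ² → ℝ satisfying (Hf)₁₁ = 0, (Hf)₁₂ = 0 and (Hf)₂₂ = −f on ℝ² (the affine quasi-Einstein equation with μ = −1) is exactly the real span of the three functions e^{x²}, x²·e^{x²}, and (2x¹ + c·(x²)²)·e^{x²}. -/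
/-- Partial derivative in the first coordinate direction. -/
noncomputable def pd1 (f : ℝ × ℝ → ℝ) : ℝ × ℝ → ℝ := fun p => fderiv ℝ f p (1, 0)

/-- Partial derivative in the second coordinate direction. -/
noncomputable def pd2 (f : ℝ × ℝ → ℝ) : ℝ × ℝ → ℝ := fun p => fderiv ℝ f p (0, 1)

lemma qe_const (F : ℝ × ℝ → ℝ) (hF : Differentiable ℝ F) (h1 : ∀ p, pd1 F p = 0)
    (h2 : ∀ p, pd2 F p = 0) : ∃ k, ∀ p, F p = k := by
  refine ⟨F 0, fun p => is_const_of_fderiv_eq_zero (𝕜 := ℝ) hF (fun q => ?_) p 0⟩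
  ext
  · simpa [pd1] using h1 q
  · simpa [pd2] using h2 q

lemma qe_poly (α β γ k : ℝ) (p : ℝ × ℝ) :
    HasFDerivAt (fun p : ℝ × ℝ => α * p.1 + β * p.2 ^ 2 + γ * p.2 + k)
      (α • ContinuousLinearMap.fst ℝ ℝ ℝ + (2 * β * p.2 + γ) • ContinuousLinearMap.snd ℝ ℝ ℝ) p := by
  have h1 : HasFDerivAt (fun p : ℝ × ℝ => p.1) (ContinuousLinearMap.fst ℝ ℝ ℝ) p := hasFDerivAt_fst
  have h2 : HasFDerivAt (fun p : ℝ × ℝ => p.2) (ContinuousLinearMap.snd ℝ ℝ ℝ) p := hasFDerivAt_snd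
  refine ((((h1.const_mul α).add ((h2.pow 2).const_mul β)).add (h2.const_mul γ)).add_const k).congr_fderiv ?_
  ext <;> simp
  ring

lemma qe_key (g : ℝ × ℝ → ℝ) (hg : Differentiable ℝ g) (α β γ : ℝ)
    (h1 : ∀ p, pd1 g p = Real.exp p.2 * α)
    (h2 : ∀ p, pd2 g p - g p = Real.exp p.2 * (2 * β * p.2 + γ)) :
    ∃ k, ∀ p, g p = Real.exp p.2 * (α * p.1 + β * p.2 ^ 2 + γ * p.2 + k) := by
  have hs : ∀ p : ℝ × ℝ, HasFDerivAt (fun p : ℝ × ℝ => p.2) (ContinuousLinearMap.snd ℝ ℝ ℝ) p :=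
    fun p => hasFDerivAt_snd
  have hd : ∀ p, HasFDerivAt (fun p : ℝ × ℝ => Real.exp (-p.2) * g p -
      (α * p.1 + β * p.2 ^ 2 + γ * p.2 + 0)) _ p :=
    fun p => (((hs p).neg.exp).mul (hg p).hasFDerivAt).sub (qe_poly α β γ 0 p)
  have he : ∀ p : ℝ × ℝ, Real.exp (-p.2) * Real.exp p.2 = 1 := fun p => by
    rw [← Real.exp_add]; simp
  obtain ⟨k, hk⟩ := qe_const _ (fun p => (hd p).differentiableAt) (fun p => by
      have := h1 p
      unfold pd1 at *
      rw [(hd p).fderiv]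
      simp [this]
      linear_combination α * he p) (fun p => by
      have := h2 p
      unfold pd2 at *
      rw [(hd p).fderiv]
      simp
      linear_combination Real.exp (-p.2) * this + (2 * β * p.2 + γ) * he p)
  refine ⟨k, fun p => ?_⟩
  have := hk p
  linear_combination Real.exp p.2 * this - g p * he p

lemma qe_comp (α β γ k : ℝ) :
    (pd1 (fun p => Real.exp p.2 * (α * p.1 + β * p.2 ^ 2 + γ * p.2 + k)) =
      fun p => Real.exp p.2 * (0 * p.1 + 0 * p.2 ^ 2 + 0 * p.2 + α)) ∧
    (pd2 (fun p => Real.exp p.2 * (α * p.1 + β * p.2 ^ 2 + γ * p.2 + k)) =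
      fun p => Real.exp p.2 * (α * p.1 + β * p.2 ^ 2 + (γ + 2 * β) * p.2 + (k + γ))) := by
  have hs : ∀ p : ℝ × ℝ, HasFDerivAt (fun p : ℝ × ℝ => p.2) (ContinuousLinearMap.snd ℝ ℝ ℝ) p :=
    fun p => hasFDerivAt_snd
  have hd : ∀ p, HasFDerivAt (fun p : ℝ × ℝ => Real.exp (p.2) *
      (α * p.1 + β * p.2 ^ 2 + γ * p.2 + k)) _ p :=
    fun p => ((hs p).exp).mul (qe_poly α β γ k p)
  constructor
  · funext p
    unfold pd1
    rw [(hd p).fderiv]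
    simp
  · funext p
    unfold pd2
    rw [(hd p).fderiv]
    simp
    ring

lemma qe_symm (f : ℝ × ℝ → ℝ) (hf : ContDiff ℝ (⊤ : ℕ∞) f) (p : ℝ × ℝ) :
    pd2 (pd1 f) p = pd1 (pd2 f) p := by
  have hd : DifferentiableAt ℝ (fderiv ℝ f) p :=
    ((hf.fderiv_right (m := 1) (by norm_cast)).differentiable (by simp)) p
  have key : ∀ v w : ℝ × ℝ, fderiv ℝ (fun q => fderiv ℝ f q v) p w
      = fderiv ℝ (fderiv ℝ f) p w v := fun v w => by
    rw [fderiv_clm_apply hd (by fun_prop)]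
    simp
  have hsym : IsSymmSndFDerivAt ℝ f p :=
    hf.contDiffAt.isSymmSndFDerivAt (by simp [minSmoothness_of_isRCLikeNormedField]; norm_cast)
  have e1 := key (1, 0) (0, 1)
  have e2 := key (0, 1) (1, 0)
  change fderiv ℝ (fun q => fderiv ℝ f q (1, 0)) p (0, 1) =
    fderiv ℝ (fun q => fderiv ℝ f q (0, 1)) p (1, 0)
  rw [e1, e2]
  exact hsym _ _

/-- For the Type A model M₄^c (Γ₁₂¹ = 1, Γ₂₂¹ = c, Γ₂₂² = 2, others zero,
ρ_s = dx²⊗dx²), the smooth solutions of the affine quasi-Einstein equation with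
μ = −1 are exactly the span of e^{x²}, x²e^{x²} and (2x¹+c(x²)²)e^{x²}. -/
theorem stmt6 (c : ℝ) (f : ℝ × ℝ → ℝ) :
    (ContDiff ℝ (⊤ : ℕ∞) f ∧
      ∀ p : ℝ × ℝ,
        pd1 (pd1 f) p - 0 * pd1 f p - 0 * pd2 f p = 0 ∧
        pd1 (pd2 f) p - 1 * pd1 f p - 0 * pd2 f p = 0 ∧
        pd2 (pd2 f) p - c * pd1 f p - 2 * pd2 f p = -(f p)) ↔
    (∃ a b d : ℝ, ∀ p : ℝ × ℝ,
      f p = a * Real.exp p.2 + b * (p.2 * Real.exp p.2)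
          + d * ((2 * p.1 + c * p.2 ^ 2) * Real.exp p.2)) := by
  constructor
  · rintro ⟨hf, h⟩
    have hdf : Differentiable ℝ f := hf.differentiable (by simp)
    have hdd : Differentiable ℝ (fderiv ℝ f) :=
      (hf.fderiv_right (m := 1) (by norm_cast)).differentiable (by simp)
    have hd1 : Differentiable ℝ (pd1 f) := fun p => (hdd p).clm_apply (by fun_prop)
    have hd2 : Differentiable ℝ (pd2 f) := fun p => (hdd p).clm_apply (by fun_prop)
    obtain ⟨m, hm⟩ := qe_key (pd1 f) hd1 0 0 0
      (fun p => by linear_combination (h p).1)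
      (fun p => by rw [qe_symm f hf]; linear_combination (h p).2.1)
    have s1 : ∀ p, pd1 (fun q => pd2 f q - f q) p = pd1 (pd2 f) p - pd1 f p := fun p => by
      unfold pd1
      rw [fderiv_fun_sub (hd2 p) (hdf p)]; simp
    have s2 : ∀ p, pd2 (fun q => pd2 f q - f q) p = pd2 (pd2 f) p - pd2 f p := fun p => by
      conv_lhs => unfold pd2
      change fderiv ℝ (fun q => pd2 f q - f q) p (0, 1) = _
      rw [fderiv_fun_sub (hd2 p) (hdf p)]; simp [pd2]
    obtain ⟨b, hb⟩ := qe_key (fun q => pd2 f q - f q) (hd2.sub hdf) 0 0 (c * m)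
      (fun p => by rw [s1]; linear_combination (h p).2.1)
      (fun p => by rw [s2]; linear_combination (h p).2.2 + c * hm p)
    obtain ⟨a, ha⟩ := qe_key f hdf m (c * m / 2) b
      (fun p => by rw [hm p]; ring) (fun p => by rw [hb p]; ring)
    exact ⟨a, b, m / 2, fun p => by rw [ha p]; ring⟩
  · rintro ⟨a, b, d, h⟩
    have hf : f = fun p => Real.exp p.2 * ((2 * d) * p.1 + (c * d) * p.2 ^ 2 + b * p.2 + a) := by
      funext p; rw [h p]; ring
    subst hf
    refine ⟨by fun_prop, fun p => ?_⟩
    simp only [(qe_comp _ _ _ _).1, (qe_comp _ _ _ _).2]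
    refine ⟨by ring, by ring, by ring⟩
end

section
/- Let κ ∈ ℝ with κ(κ+1) ≠ 0 and set μ = −(1 + 4κ(1+κ))/(4κ(1+κ)). For the Type B connection Z₁^κ on the half-plane {x¹ > 0} (Christoffel symbols Γ_{11}^1 = 2κ/x¹, Γ_{11}^2 = 1/x¹, Γ_{12}^2 = κ/x¹, others zero, with ρ_s = κ(1+κ)(x¹)^{-2}·dx¹⊗dx¹), the set of smooth f satisfying (Hf)₁₁ = μκ(1+κ)(x¹)^{-2}·f, (Hf)₁₂ = 0 and (Hf)₂₂ = 0 is exactly the real span of the two functions (x¹)^{κ+1/2} and (x¹)^{κ+1/2}·log x¹. -/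
lemma aux_pd (f : ℝ × ℝ → ℝ) (φ : ℝ → ℝ) (d : ℝ) (p : ℝ × ℝ) (hp : 0 < p.1)
    (hf : ∀ q : ℝ × ℝ, 0 < q.1 → f q = φ q.1) (hφ : HasDerivAt φ d p.1) :
    pd1 f p = d ∧ pd2 f p = 0 := by
  have ho : IsOpen {q : ℝ × ℝ | 0 < q.1} := isOpen_lt continuous_const continuous_fst
  have h1 : HasFDerivAt (fun q : ℝ × ℝ => φ q.1) (d • ContinuousLinearMap.fst ℝ ℝ ℝ) p :=
    hφ.comp_hasFDerivAt p hasFDerivAt_fst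
  have h2 : f =ᶠ[nhds p] (fun q : ℝ × ℝ => φ q.1) := by
    filter_upwards [ho.mem_nhds hp] with q hq using hf q hq
  have h3 := (h1.congr_of_eventuallyEq h2).fderiv
  simp [pd1, pd2, h3]

lemma aux_s1 (f : ℝ × ℝ → ℝ) (x y : ℝ) (h : DifferentiableAt ℝ f (x, y)) :
    HasDerivAt (fun t => f (t, y)) (pd1 f (x, y)) x := by
  have h1 : HasDerivAt (fun t : ℝ => (t, y)) ((1 : ℝ), (0 : ℝ)) x :=
    (hasDerivAt_id x).prodMk (hasDerivAt_const x y)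
  exact h.hasFDerivAt.comp_hasDerivAt x h1

lemma aux_s2 (f : ℝ × ℝ → ℝ) (x y : ℝ) (h : DifferentiableAt ℝ f (x, y)) :
    HasDerivAt (fun t => f (x, t)) (pd2 f (x, y)) y := by
  have h1 : HasDerivAt (fun t : ℝ => (x, t)) ((0 : ℝ), (1 : ℝ)) y :=
    (hasDerivAt_const y x).prodMk (hasDerivAt_id y)
  exact h.hasFDerivAt.comp_hasDerivAt y h1

lemma aux_constR (g : ℝ → ℝ) (h : ∀ x, HasDerivAt g 0 x) (x y : ℝ) : g x = g y :=
  is_const_of_deriv_eq_zero (fun x => (h x).differentiableAt) (fun x => (h x).deriv) x y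

lemma aux_const (g : ℝ → ℝ) (h : ∀ x, 0 < x → HasDerivAt g 0 x) (x : ℝ) (hx : 0 < x) :
    g x = g 1 :=
  isOpen_Ioi.is_const_of_deriv_eq_zero (s := Set.Ioi (0:ℝ)) isPreconnected_Ioi
    (fun x hx => (h x hx).differentiableAt.differentiableWithinAt)
    (fun x hx => (h x hx).deriv) hx (by simp)

lemma aux_ode (s : ℝ) (g g1 g2 : ℝ → ℝ) (h1 : ∀ x, 0 < x → HasDerivAt g (g1 x) x)
    (h2 : ∀ x, 0 < x → HasDerivAt g1 (g2 x) x)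
    (he : ∀ x, 0 < x → x ^ 2 * g2 x = (2 * s - 1) * x * g1 x - s ^ 2 * g x) :
    ∃ a b : ℝ, ∀ x, 0 < x → g x = a * x ^ s + b * (x ^ s * Real.log x) := by
  have hr : ∀ x : ℝ, 0 < x → HasDerivAt (fun t : ℝ => t ^ (-s)) (-s * (x ^ (-s) / x)) x := by
    intro x hx
    have := Real.hasDerivAt_rpow_const (x := x) (p := -s) (Or.inl hx.ne')
    rwa [Real.rpow_sub_one hx.ne'] at this
  have k1 := aux_const (fun x => (x * g1 x - s * g x) * x ^ (-s)) (by
    intro x hx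
    have := ((((hasDerivAt_id x).mul (h2 x hx)).sub ((h1 x hx).const_mul s)).mul (hr x hx))
    refine this.congr_deriv ?_
    have e := he x hx
    have : g2 x = ((2 * s - 1) * x * g1 x - s ^ 2 * g x) / x ^ 2 := by
      field_simp; linarith
    simp only [this, id, Pi.mul_apply, Pi.sub_apply]
    field_simp
    ring)
  set b := (1 * g1 1 - s * g 1) * 1 ^ (-s) with hb
  have k2 := aux_const (fun x => g x * x ^ (-s) - b * Real.log x) (by
    intro x hx
    have := ((h1 x hx).mul (hr x hx)).sub ((Real.hasDerivAt_log hx.ne').const_mul b)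
    refine this.congr_deriv ?_
    have e := k1 x hx
    rw [← e]
    field_simp
    ring)
  refine ⟨g 1 * 1 ^ (-s) - b * Real.log 1, b, fun x hx => ?_⟩
  rw [← k2 x hx]
  have : x ^ (-s) * x ^ s = 1 := by rw [← Real.rpow_add hx]; simp
  linear_combination -(g x) * this

/-- For the Type B model Z₁^κ with κ(κ+1) ≠ 0 and the critical eigenvalue
μ = −(1 + 4κ(1+κ))/(4κ(1+κ)), the smooth solutions of the affine quasi-Einstein
equation on {x¹ > 0} are exactly the span of (x¹)^{κ+1/2} and (x¹)^{κ+1/2} log x¹. -/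
theorem stmt10 (κ μ : ℝ) (hκ : κ * (κ + 1) ≠ 0)
    (hμ : μ = -(1 + 4 * κ * (1 + κ)) / (4 * κ * (1 + κ))) (f : ℝ × ℝ → ℝ) :
    (ContDiffOn ℝ (⊤ : ℕ∞) f {p : ℝ × ℝ | 0 < p.1} ∧
      ∀ p : ℝ × ℝ, 0 < p.1 →
        pd1 (pd1 f) p - (2 * κ / p.1) * pd1 f p - (1 / p.1) * pd2 f p
          = μ * (κ * (1 + κ) / p.1 ^ 2) * f p ∧
        pd1 (pd2 f) p - (κ / p.1) * pd2 f p = 0 ∧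
        pd2 (pd2 f) p = 0) ↔
    (∃ a b : ℝ, ∀ p : ℝ × ℝ, 0 < p.1 →
      f p = a * p.1 ^ (κ + 1 / 2) + b * (p.1 ^ (κ + 1 / 2) * Real.log p.1)) := by
  have hμ' : μ * (κ * (1 + κ)) = -(κ + 1 / 2) ^ 2 := by
    have h1 : κ ≠ 0 := left_ne_zero_of_mul hκ
    have h2 : 1 + κ ≠ 0 := by rw [add_comm]; exact right_ne_zero_of_mul hκ
    rw [hμ]; field_simp; ring
  clear hμ
  have ho : IsOpen {q : ℝ × ℝ | 0 < q.1} := isOpen_lt continuous_const continuous_fst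
  constructor
  · rintro ⟨hf, he⟩
    have hfd : ContDiffOn ℝ (⊤ : ℕ∞) (fderiv ℝ f) {p : ℝ × ℝ | 0 < p.1} :=
      hf.fderiv_of_isOpen ho (by simp)
    have d0 : ∀ x y : ℝ, 0 < x → DifferentiableAt ℝ f (x, y) := fun x y hx =>
      (hf.differentiableOn (by simp)).differentiableAt (ho.mem_nhds hx)
    have dd : ∀ x y : ℝ, 0 < x → DifferentiableAt ℝ (fderiv ℝ f) (x, y) := fun x y hx =>
      (hfd.differentiableOn (by simp)).differentiableAt (ho.mem_nhds hx)
    have d1 : ∀ x y : ℝ, 0 < x → DifferentiableAt ℝ (pd1 f) (x, y) := fun x y hx =>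
      (dd x y hx).clm_apply (differentiableAt_const _)
    have d2 : ∀ x y : ℝ, 0 < x → DifferentiableAt ℝ (pd2 f) (x, y) := fun x y hx =>
      (dd x y hx).clm_apply (differentiableAt_const _)
    -- pd2 f is independent of y
    have c1 : ∀ x y : ℝ, 0 < x → pd2 f (x, y) = pd2 f (x, 0) := fun x y hx =>
      aux_constR (fun t => pd2 f (x, t)) (fun t => by
        have := aux_s2 (pd2 f) x t (d2 x t hx)
        rwa [(he (x, t) hx).2.2] at this) y 0
    have c2 : ∀ x y : ℝ, 0 < x → f (x, y) = f (x, 0) + y * pd2 f (x, 0) := by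
      intro x y hx
      have := aux_constR (fun t => f (x, t) - t * pd2 f (x, 0)) (fun t => by
        have := (aux_s2 f x t (d0 x t hx)).sub ((hasDerivAt_id t).mul_const (pd2 f (x, 0)))
        refine this.congr_deriv ?_
        rw [c1 x t hx]; ring) y 0
      linarith
    have hH : ∀ x : ℝ, 0 < x → HasDerivAt (fun t => pd2 f (t, 0)) (κ / x * pd2 f (x, 0)) x := by
      intro x hx
      have := aux_s1 (pd2 f) x 0 (d2 x 0 hx)
      refine this.congr_deriv ?_
      have := (he (x, 0) hx).2.1
      simp only at this
      linarith
    have c3 : ∀ x : ℝ, 0 < x → pd1 f (x, 1) - pd1 f (x, 0) = κ / x * pd2 f (x, 0) := by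
      intro x hx
      have h := (aux_s1 f x 1 (d0 x 1 hx)).sub (aux_s1 f x 0 (d0 x 0 hx))
      refine h.unique ((hH x hx).congr_of_eventuallyEq ?_)
      filter_upwards [isOpen_Ioi.mem_nhds hx] with t ht
      have := c2 t 1 ht
      simp only [Pi.sub_apply]
      linarith
    have c4 : ∀ x : ℝ, 0 < x → pd1 (pd1 f) (x, 1) - pd1 (pd1 f) (x, 0)
        = (κ ^ 2 - κ) / x ^ 2 * pd2 f (x, 0) := by
      intro x hx
      have h := (aux_s1 (pd1 f) x 1 (d1 x 1 hx)).sub (aux_s1 (pd1 f) x 0 (d1 x 0 hx))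
      have h' := ((hasDerivAt_inv hx.ne').const_mul κ).mul (hH x hx)
      rw [h.unique (h'.congr_of_eventuallyEq ?_)]
      · field_simp
        ring
      · filter_upwards [isOpen_Ioi.mem_nhds hx] with t ht
        have := c3 t ht
        simp only [Pi.sub_apply, Pi.mul_apply]
        rw [this, div_eq_mul_inv]
    have c5 : ∀ x : ℝ, 0 < x → pd2 f (x, 0) = 0 := by
      intro x hx
      have e1 := (he (x, 1) hx).1
      have e0 := (he (x, 0) hx).1
      simp only [← mul_div_assoc, hμ'] at e1 e0
      rw [c1 x 1 hx, c2 x 1 hx] at e1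
      have e3 := c3 x hx
      have e4 := c4 x hx
      have key : (κ ^ 2 - κ) / x ^ 2 * pd2 f (x, 0) - 2 * κ / x * (κ / x * pd2 f (x, 0))
          = -(κ + 1 / 2) ^ 2 / x ^ 2 * pd2 f (x, 0) := by
        rw [← e4]
        linear_combination e1 - e0 + 2 * κ / x * e3
      field_simp at key
      linarith
    obtain ⟨a, b, hab⟩ := aux_ode (κ + 1 / 2) (fun x => f (x, 0)) (fun x => pd1 f (x, 0))
      (fun x => pd1 (pd1 f) (x, 0)) (fun x hx => aux_s1 f x 0 (d0 x 0 hx))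
      (fun x hx => aux_s1 (pd1 f) x 0 (d1 x 0 hx)) (fun x hx => by
        have e0 := (he (x, 0) hx).1
        simp only [← mul_div_assoc, hμ', c5 x hx] at e0
        have : pd1 (pd1 f) (x, 0) = 2 * κ / x * pd1 f (x, 0)
          + -(κ + 1 / 2) ^ 2 / x ^ 2 * f (x, 0) := by linarith
        simp only [this]
        field_simp
        ring)
    refine ⟨a, b, fun p hp => ?_⟩
    have := c2 p.1 p.2 hp
    rw [c5 p.1 hp] at this
    rw [← hab p.1 hp]
    simpa using this
  · rintro ⟨a, b, hf⟩
    set s := κ + 1 / 2 with hs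
    have hr : ∀ (r x : ℝ), 0 < x → HasDerivAt (fun t : ℝ => t ^ r) (r * (x ^ r / x)) x := by
      intro r x hx
      have := Real.hasDerivAt_rpow_const (x := x) (p := r) (Or.inl hx.ne')
      rwa [Real.rpow_sub_one hx.ne'] at this
    have key : ∀ (r a b x : ℝ), 0 < x →
        HasDerivAt (fun t : ℝ => a * t ^ r + b * (t ^ r * Real.log t))
          ((a * r + b) * x ^ (r - 1) + (b * r) * (x ^ (r - 1) * Real.log x)) x := by
      intro r a b x hx
      have := ((hr r x hx).const_mul a).add
        (((hr r x hx).mul (Real.hasDerivAt_log hx.ne')).const_mul b)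
      refine this.congr_deriv ?_
      rw [Real.rpow_sub_one hx.ne']
      field_simp
      ring
    have p1 := fun (p : ℝ × ℝ) (hp : 0 < p.1) => aux_pd f _ _ p hp hf (key s a b p.1 hp)
    have p11 := fun (p : ℝ × ℝ) (hp : 0 < p.1) =>
      aux_pd (pd1 f) _ _ p hp (fun q hq => (p1 q hq).1) (key (s - 1) _ _ p.1 hp)
    have p2 := fun (p : ℝ × ℝ) (hp : 0 < p.1) =>
      aux_pd (pd2 f) (fun _ => 0) 0 p hp (fun q hq => (p1 q hq).2) (hasDerivAt_const _ _)
    refine ⟨?_, fun p hp => ⟨?_, ?_, (p2 p hp).2⟩⟩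
    · refine ContDiffOn.congr ?_ hf
      intro p hp
      have hp' : p.1 ≠ 0 := ne_of_gt hp
      have h1 : ContDiffAt ℝ (⊤ : ℕ∞) (fun q : ℝ × ℝ => q.1 ^ s) p :=
        contDiffAt_fst.rpow_const_of_ne hp'
      have h2 : ContDiffAt ℝ (⊤ : ℕ∞) (fun q : ℝ × ℝ => Real.log q.1) p :=
        contDiffAt_fst.log hp'
      exact ((contDiffAt_const.mul h1).add (contDiffAt_const.mul (h1.mul h2))).contDiffWithinAt
    · rw [(p11 p hp).1, (p1 p hp).1, (p1 p hp).2, hf p hp, ← mul_div_assoc, hμ',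
        Real.rpow_sub_one hp.ne', Real.rpow_sub_one hp.ne']
      have : κ = s - 1 / 2 := by rw [hs]; ring
      rw [this]
      field_simp
      ring
    · rw [(p2 p hp).1, (p1 p hp).2]; ring
end

section
/- Let κ, θ ∈ ℝ with θ ≠ 0. Consider the Type B connection on the half-plane {x¹ > 0} with Christoffel symbols Γ_{11}^1 = (2κ+θ−1)/x¹, Γ_{12}^2 = Γ_{21}^2 = κ/x¹ and all other Γ_{ij}^k = 0 (the model Z₂^{κ,θ}, whose symmetric Ricci tensor is ρ_s = κ(κ+θ)(x¹)^{-2}·dx¹⊗dx¹). The set of smooth f on {x¹ > 0} satisfying (Hf)₁₁ = −κ(κ+θ)(x¹)^{-2}·f, (Hf)₁₂ = 0 and (Hf)₂₂ = 0 (the affine quasi-Einstein equation with μ = −1) is exactly the real span of the three functions (x¹)^κ, (x¹)^κ·x², and (x¹)^{κ+θ}. -/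
theorem aux_zero (w : ℝ → ℝ) (h : ∀ x, 0 < x → HasDerivAt w 0 x) (x : ℝ) (hx : 0 < x) :
    w x = w 1 := by
  refine (convex_Ioi (0 : ℝ)).is_const_of_fderivWithin_eq_zero (𝕜 := ℝ) (f := w)
    (fun y hy => (h y hy).differentiableAt.differentiableWithinAt) (fun y hy => ?_)
    (Set.mem_Ioi.2 hx) (Set.mem_Ioi.2 one_pos)
  rw [fderivWithin_of_isOpen isOpen_Ioi hy]
  have := (h y hy).hasFDerivAt.fderiv
  rw [this]; ext; simp

theorem aux_pow (w : ℝ → ℝ) (k : ℝ) (h : ∀ x, 0 < x → HasDerivAt w (k / x * w x) x)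
    (x : ℝ) (hx : 0 < x) : w x = w 1 * x ^ k := by
  have h1 := aux_zero (fun x => w x * x ^ (-k)) (fun x hx => by
    have := (h x hx).mul (Real.hasDerivAt_rpow_const (p := -k) (Or.inl hx.ne'))
    refine this.congr_deriv ?_
    rw [Real.rpow_sub_one hx.ne']
    field_simp
    ring) x hx
  simp only [Real.one_rpow, mul_one] at h1
  rw [← h1, mul_assoc, ← Real.rpow_add hx]; simp

theorem aux_zero' (w : ℝ → ℝ) (h : ∀ x, HasDerivAt w 0 x) (x y : ℝ) : w x = w y :=
  is_const_of_deriv_eq_zero (fun x => (h x).differentiableAt) (fun x => (h x).deriv) x y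

theorem aux_open : IsOpen {p : ℝ × ℝ | 0 < p.1} := isOpen_lt continuous_const continuous_fst

theorem aux_d1 (f : ℝ × ℝ → ℝ) (x y : ℝ) (h : DifferentiableAt ℝ f (x, y)) :
    HasDerivAt (fun s => f (s, y)) (pd1 f (x, y)) x :=
  h.hasFDerivAt.comp_hasDerivAt x ((hasDerivAt_id x).prodMk (hasDerivAt_const x y))

theorem aux_d2 (f : ℝ × ℝ → ℝ) (x y : ℝ) (h : DifferentiableAt ℝ f (x, y)) :
    HasDerivAt (fun s => f (x, s)) (pd2 f (x, y)) y :=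
  h.hasFDerivAt.comp_hasDerivAt y ((hasDerivAt_const y x).prodMk (hasDerivAt_id y))

theorem aux_smooth (f : ℝ × ℝ → ℝ) (h : ContDiffOn ℝ (⊤ : ℕ∞) f {p : ℝ × ℝ | 0 < p.1})
    (v p : ℝ × ℝ) (hp : 0 < p.1) : DifferentiableAt ℝ (fun p => fderiv ℝ f p v) p := by
  have h1 : ContDiffAt ℝ (⊤ : ℕ∞) f p := h.contDiffAt (aux_open.mem_nhds hp)
  have h2 : ContDiffAt ℝ 1 (fderiv ℝ f) p :=
    h1.fderiv_right (by norm_cast)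
  exact (h2.differentiableAt (by norm_num)).clm_apply (differentiableAt_const v)

theorem aux_form (f : ℝ × ℝ → ℝ) (φ ψ φ' ψ' : ℝ → ℝ)
    (hf : ∀ p : ℝ × ℝ, 0 < p.1 → f p = φ p.1 + ψ p.1 * p.2)
    (hφ : ∀ x, 0 < x → HasDerivAt φ (φ' x) x) (hψ : ∀ x, 0 < x → HasDerivAt ψ (ψ' x) x)
    (p : ℝ × ℝ) (hp : 0 < p.1) :
    pd1 f p = φ' p.1 + ψ' p.1 * p.2 ∧ pd2 f p = ψ p.1 := by
  have h1 : HasFDerivAt (fun p : ℝ × ℝ => φ p.1 + ψ p.1 * p.2) _ p :=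
    ((hφ p.1 hp).comp_hasFDerivAt p hasFDerivAt_fst).add
      (((hψ p.1 hp).comp_hasFDerivAt p hasFDerivAt_fst).mul (hasFDerivAt_snd (𝕜 := ℝ) (E := ℝ) (F := ℝ) (p := p)))
  have h2 := h1.congr_of_eventuallyEq (f₁ := f)
    (Filter.eventually_of_mem (aux_open.mem_nhds hp) hf)
  unfold pd1 pd2
  rw [h2.fderiv]
  constructor <;> simp
  ring

/-- For the Type B model Z₂^{κ,θ} (Γ₁₁¹ = (2κ+θ−1)/x¹, Γ₁₂² = κ/x¹, others zero,
ρ_s = κ(κ+θ)(x¹)⁻²dx¹⊗dx¹, θ ≠ 0) on {x¹ > 0}, the smooth solutions of the affine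
quasi-Einstein equation with μ = −1 are exactly the span of (x¹)^κ, (x¹)^κ x² and
(x¹)^{κ+θ}. -/
theorem stmt11 (κ θ : ℝ) (hθ : θ ≠ 0) (f : ℝ × ℝ → ℝ) :
    (ContDiffOn ℝ (⊤ : ℕ∞) f {p : ℝ × ℝ | 0 < p.1} ∧
      ∀ p : ℝ × ℝ, 0 < p.1 →
        pd1 (pd1 f) p - ((2 * κ + θ - 1) / p.1) * pd1 f p
          = -(κ * (κ + θ) / p.1 ^ 2) * f p ∧
        pd1 (pd2 f) p - (κ / p.1) * pd2 f p = 0 ∧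
        pd2 (pd2 f) p = 0) ↔
    (∃ a b c : ℝ, ∀ p : ℝ × ℝ, 0 < p.1 →
      f p = a * p.1 ^ κ + b * (p.1 ^ κ * p.2) + c * p.1 ^ (κ + θ)) := by
  constructor
  · rintro ⟨hs, h⟩
    have hd : ∀ p : ℝ × ℝ, 0 < p.1 → DifferentiableAt ℝ f p := fun p hp =>
      (hs.contDiffAt (aux_open.mem_nhds hp)).differentiableAt (by simp)
    have hd1 : ∀ p : ℝ × ℝ, 0 < p.1 → DifferentiableAt ℝ (pd1 f) p :=
      fun p hp => aux_smooth f hs (1, 0) p hp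
    have hd2 : ∀ p : ℝ × ℝ, 0 < p.1 → DifferentiableAt ℝ (pd2 f) p :=
      fun p hp => aux_smooth f hs (0, 1) p hp
    have hB0 : ∀ x, 0 < x → pd2 f (x, 0) = pd2 f (1, 0) * x ^ κ := by
      refine aux_pow (fun x => pd2 f (x, 0)) κ fun x hx => ?_
      refine (aux_d1 _ x 0 (hd2 (x, 0) hx)).congr_deriv ?_
      have := (h (x, 0) hx).2.1
      simp only at this ⊢
      linarith
    have hB : ∀ x y, 0 < x → pd2 f (x, y) = pd2 f (1, 0) * x ^ κ := by
      intro x y hx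
      rw [← hB0 x hx]
      refine aux_zero' (fun y => pd2 f (x, y)) (fun y => ?_) y 0
      exact (aux_d2 _ x y (hd2 (x, y) hx)).congr_deriv (h (x, y) hx).2.2
    have hF : ∀ x y, 0 < x → f (x, y) - pd2 f (1, 0) * x ^ κ * y = f (x, 0) := by
      intro x y hx
      have := aux_zero' (fun y => f (x, y) - pd2 f (1, 0) * x ^ κ * y) (fun y => by
        refine ((aux_d2 _ x y (hd (x, y) hx)).sub
          ((hasDerivAt_id y).const_mul (pd2 f (1, 0) * x ^ κ))).congr_deriv ?_
        rw [hB x y hx]; ring) y 0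
      simpa using this
    have key : ∀ k l : ℝ, k + l = 2 * κ + θ → k * l = κ * (κ + θ) → ∃ C : ℝ, ∀ x, 0 < x →
        x * pd1 f (x, 0) - k * f (x, 0) = C * x ^ l := by
      intro k l h1 h2
      refine ⟨_, aux_pow (fun x => x * pd1 f (x, 0) - k * f (x, 0)) l fun x hx => ?_⟩
      refine (((hasDerivAt_id x).mul (aux_d1 _ x 0 (hd1 (x, 0) hx))).sub
        ((aux_d1 _ x 0 (hd (x, 0) hx)).const_mul k)).congr_deriv ?_
      have := (h (x, 0) hx).1
      simp only [id] at this ⊢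
      have e : pd1 (pd1 f) (x, 0) = (k + l - 1) / x * pd1 f (x, 0) - k * l / x ^ 2 * f (x, 0) := by
        rw [h1, h2]; linarith
      rw [e]
      field_simp
      ring
    obtain ⟨C, hC⟩ := key κ (κ + θ) (by ring) rfl
    obtain ⟨D, hD⟩ := key (κ + θ) κ (by ring) (by ring)
    refine ⟨-D / θ, pd2 f (1, 0), C / θ, ?_⟩
    rintro ⟨x, y⟩ hx
    have e1 := hF x y hx
    have e2 := hC x hx
    have e3 := hD x hx
    have e4 : f (x, 0) = (C * x ^ (κ + θ) - D * x ^ κ) / θ := by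
      rw [eq_div_iff hθ]; linarith
    rw [e4] at e1
    simp only
    rw [sub_eq_iff_eq_add] at e1
    rw [e1]; ring
  · rintro ⟨a, b, c, h⟩
    have hp : ∀ k x : ℝ, 0 < x → HasDerivAt (fun x : ℝ => x ^ k) (k * x ^ (k - 1)) x :=
      fun k x hx => Real.hasDerivAt_rpow_const (Or.inl hx.ne')
    have H := aux_form f (fun x => a * x ^ κ + c * x ^ (κ + θ)) (fun x => b * x ^ κ)
      _ _ (fun p hp => by rw [h p hp]; ring)
      (fun x hx => ((hp κ x hx).const_mul a).add ((hp (κ + θ) x hx).const_mul c))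
      (fun x hx => (hp κ x hx).const_mul b)
    have H1 := aux_form (pd1 f) _ _ _ _ (fun p hp => (H p hp).1)
      (fun x hx => (((hp (κ - 1) x hx).const_mul κ).const_mul a).add
        (((hp (κ + θ - 1) x hx).const_mul (κ + θ)).const_mul c))
      (fun x hx => ((hp (κ - 1) x hx).const_mul κ).const_mul b)
    have H2 := aux_form (pd2 f) (fun x => b * x ^ κ) (fun _ => 0) _ _
      (fun p hp => by rw [(H p hp).2]; ring)
      (fun x hx => (hp κ x hx).const_mul b) (fun x _ => hasDerivAt_const x 0)
    refine ⟨?_, ?_⟩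
    · refine ContDiffOn.congr (f := fun p : ℝ × ℝ =>
        a * p.1 ^ κ + b * (p.1 ^ κ * p.2) + c * p.1 ^ (κ + θ)) ?_ h
      have hr : ∀ k : ℝ, ContDiffOn ℝ (⊤ : ℕ∞) (fun p : ℝ × ℝ => p.1 ^ k)
          {p : ℝ × ℝ | 0 < p.1} := fun k =>
        contDiff_fst.contDiffOn.rpow_const_of_ne (fun p hp => ne_of_gt hp)
      exact ((contDiffOn_const.mul (hr κ)).add (contDiffOn_const.mul
        ((hr κ).mul contDiff_snd.contDiffOn))).add (contDiffOn_const.mul (hr (κ + θ)))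
    · intro p hx
      rw [(H1 p hx).1, (H2 p hx).1, (H2 p hx).2, (H p hx).1, (H p hx).2, h p hx]
      have hn := hx.ne'
      simp only [Real.rpow_sub_one hn]
      refine ⟨?_, ?_, trivial⟩
      · field_simp
        ring
      · field_simp
        ring
end

section
/- Consider on the strip M = (−π/2, π/2) × ℝ the Levi-Civita connection of the round-sphere metric dx¹⊗dx¹ + cos²(x¹)·dx²⊗dx², with Christoffel symbols Γ_{12}^2 = Γ_{21}^2 = −tan(x¹), Γ_{22}^1 = cos(x¹)sin(x¹) and all other Γ_{ij}^k = 0; its Ricci tensor is ρ_s = dx¹⊗dx¹ + cos²(x¹)·dx²⊗dx². The set of smooth f : M → ℝ satisfying (Hf)₁₁ = −f, (Hf)₁₂ = 0 and (Hf)₂₂ = −cos²(x¹)·f (the affine quasi-Einstein equation with μ = −1) is exactly the real span of the three functions sin(x¹), cos(x¹)cos(x²), and cos(x¹)sin(x²). -/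
def strip : Set (ℝ × ℝ) := {p : ℝ × ℝ | -(Real.pi / 2) < p.1 ∧ p.1 < Real.pi / 2}

lemma strip_open : IsOpen strip :=
  (isOpen_lt continuous_const continuous_fst).inter (isOpen_lt continuous_fst continuous_const)

lemma hasDeriv_pd1 {g : ℝ × ℝ → ℝ} {p : ℝ × ℝ} (h : DifferentiableAt ℝ g p) :
    HasDerivAt (fun t => g (t, p.2)) (pd1 g p) p.1 := by
  have h2 : HasDerivAt (fun t : ℝ => (t, p.2)) ((1 : ℝ), (0 : ℝ)) p.1 :=
    (hasDerivAt_id p.1).prodMk (hasDerivAt_const p.1 p.2)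
  exact HasFDerivAt.comp_hasDerivAt (f := fun t : ℝ => (t, p.2)) p.1 h.hasFDerivAt h2

lemma hasDeriv_pd2 {g : ℝ × ℝ → ℝ} {p : ℝ × ℝ} (h : DifferentiableAt ℝ g p) :
    HasDerivAt (fun t => g (p.1, t)) (pd2 g p) p.2 := by
  have h2 : HasDerivAt (fun t : ℝ => (p.1, t)) ((0 : ℝ), (1 : ℝ)) p.2 :=
    (hasDerivAt_const p.2 p.1).prodMk (hasDerivAt_id p.2)
  exact HasFDerivAt.comp_hasDerivAt (f := fun t : ℝ => (p.1, t)) p.2 h.hasFDerivAt h2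

lemma pd1_eq {f g : ℝ × ℝ → ℝ} (he : ∀ p ∈ strip, f p = g p) (hg : Differentiable ℝ g)
    {p : ℝ × ℝ} (hp : p ∈ strip) {d : ℝ} (hd : HasDerivAt (fun t => g (t, p.2)) d p.1) :
    pd1 f p = d := by
  have : f =ᶠ[nhds p] g := Filter.eventually_of_mem (strip_open.mem_nhds hp) he
  have h1 : pd1 f p = pd1 g p := by unfold pd1; rw [this.fderiv_eq]
  rw [h1]
  exact (hasDeriv_pd1 (hg p)).unique hd

lemma pd2_eq {f g : ℝ × ℝ → ℝ} (he : ∀ p ∈ strip, f p = g p) (hg : Differentiable ℝ g)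
    {p : ℝ × ℝ} (hp : p ∈ strip) {d : ℝ} (hd : HasDerivAt (fun t => g (p.1, t)) d p.2) :
    pd2 f p = d := by
  have : f =ᶠ[nhds p] g := Filter.eventually_of_mem (strip_open.mem_nhds hp) he
  have h1 : pd2 f p = pd2 g p := by unfold pd2; rw [this.fderiv_eq]
  rw [h1]
  exact (hasDeriv_pd2 (hg p)).unique hd

lemma const_of_deriv {s : Set ℝ} (hs : IsOpen s) (hc : IsPreconnected s) (h0 : (0 : ℝ) ∈ s)
    {g : ℝ → ℝ} (hg : ∀ x ∈ s, HasDerivAt g 0 x) : ∀ x ∈ s, g x = g 0 := by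
  intro x hx
  exact hs.is_const_of_deriv_eq_zero hc
    (fun y hy => (hg y hy).differentiableAt.differentiableWithinAt)
    (fun y hy => (hg y hy).deriv) hx h0

lemma ode {s : Set ℝ} (hs : IsOpen s) (hc : IsPreconnected s) (h0 : (0 : ℝ) ∈ s)
    {g h : ℝ → ℝ} (hg : ∀ x ∈ s, HasDerivAt g (h x) x) (hh : ∀ x ∈ s, HasDerivAt h (-g x) x) :
    ∀ x ∈ s, g x = h 0 * Real.sin x + g 0 * Real.cos x := by
  intro x hx
  have A := const_of_deriv hs hc h0 (g := fun x => g x * Real.sin x + h x * Real.cos x)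
    (fun y hy => by
      refine HasDerivAt.congr_deriv (((hg y hy).fun_mul (Real.hasDerivAt_sin y)).fun_add
        ((hh y hy).fun_mul (Real.hasDerivAt_cos y))) ?_
      ring) x hx
  have B := const_of_deriv hs hc h0 (g := fun x => g x * Real.cos x - h x * Real.sin x)
    (fun y hy => by
      refine HasDerivAt.congr_deriv (((hg y hy).fun_mul (Real.hasDerivAt_cos y)).fun_sub
        ((hh y hy).fun_mul (Real.hasDerivAt_sin y))) ?_
      ring) x hx
  simp at A B
  rw [← A, ← B]
  linear_combination (-g x) * Real.sin_sq_add_cos_sq x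

lemma forward (f : ℝ × ℝ → ℝ) (hf : ContDiffOn ℝ (⊤ : ℕ∞) f strip)
    (h1 : ∀ p ∈ strip, pd1 (pd1 f) p = -(f p))
    (h2 : ∀ p ∈ strip, pd1 (pd2 f) p - (-Real.tan p.1) * pd2 f p = 0)
    (h3 : ∀ p ∈ strip, pd2 (pd2 f) p - (Real.cos p.1 * Real.sin p.1) * pd1 f p
          = -((Real.cos p.1) ^ 2 * f p)) :
    ∃ a b c : ℝ, ∀ p ∈ strip,
      f p = a * Real.sin p.1 + b * (Real.cos p.1 * Real.cos p.2)
          + c * (Real.cos p.1 * Real.sin p.2) := by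
  have hle : (2 : WithTop ℕ∞) ≤ ((⊤ : ℕ∞) : WithTop ℕ∞) :=
    WithTop.coe_le_coe.2 (le_top : (2 : ℕ∞) ≤ ⊤)
  have hpi := Real.pi_pos
  have hat : ∀ p ∈ strip, ContDiffAt ℝ (⊤ : ℕ∞) f p := fun p hp =>
    hf.contDiffAt (strip_open.mem_nhds hp)
  have d0 : ∀ p ∈ strip, DifferentiableAt ℝ f p := fun p hp =>
    (hat p hp).differentiableAt (by simp)
  have dd : ∀ p ∈ strip, DifferentiableAt ℝ (fderiv ℝ f) p := fun p hp =>
    ((hat p hp).fderiv_right (m := 1) (by rw [one_add_one_eq_two]; exact hle)).differentiableAt (by simp)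
  have d1 : ∀ p ∈ strip, DifferentiableAt ℝ (pd1 f) p := fun p hp =>
    (dd p hp).clm_apply (differentiableAt_const _)
  have d2 : ∀ p ∈ strip, DifferentiableAt ℝ (pd2 f) p := fun p hp =>
    (dd p hp).clm_apply (differentiableAt_const _)
  have sym : ∀ p ∈ strip, pd2 (pd1 f) p = pd1 (pd2 f) p := by
    intro p hp
    have hs : IsSymmSndFDerivAt ℝ f p :=
      (hat p hp).isSymmSndFDerivAt (by simpa using hle)
    have e1 : pd2 (pd1 f) p = fderiv ℝ (fderiv ℝ f) p (0, 1) (1, 0) := by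
      unfold pd2 pd1
      rw [fderiv_clm_apply (dd p hp) (differentiableAt_const _)]
      simp
    have e2 : pd1 (pd2 f) p = fderiv ℝ (fderiv ℝ f) p (1, 0) (0, 1) := by
      unfold pd2 pd1
      rw [fderiv_clm_apply (dd p hp) (differentiableAt_const _)]
      simp
    rw [e1, e2]
    exact hs _ _
  have z : ∀ y : ℝ, ((0 : ℝ), y) ∈ strip := fun y => ⟨by simp; linarith, by simp; linarith⟩
  have hA : ∀ y : ℝ, pd1 f (0, y) = pd1 f (0, 0) := fun y =>
    const_of_deriv isOpen_univ isPreconnected_univ (Set.mem_univ _)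
      (g := fun y => pd1 f (0, y)) (fun t _ => by
        have := hasDeriv_pd2 (d1 _ (z t))
        have e := h2 _ (z t)
        rw [sym _ (z t)] at this
        simp at e
        rw [e] at this
        exact this) y (Set.mem_univ _)
  have hB : ∀ y : ℝ, f (0, y) = pd2 f (0, 0) * Real.sin y + f (0, 0) * Real.cos y := fun y =>
    ode isOpen_univ isPreconnected_univ (Set.mem_univ _)
      (g := fun y => f (0, y)) (h := fun y => pd2 f (0, y))
      (fun t _ => hasDeriv_pd2 (d0 _ (z t)))
      (fun t _ => by
        have := hasDeriv_pd2 (d2 _ (z t))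
        have e := h3 _ (z t)
        simp at e
        rw [e] at this
        exact this) y (Set.mem_univ _)
  refine ⟨pd1 f (0, 0), f (0, 0), pd2 f (0, 0), ?_⟩
  rintro ⟨x, y⟩ hp
  have := ode (s := Set.Ioo (-(Real.pi / 2)) (Real.pi / 2)) isOpen_Ioo isPreconnected_Ioo
      (⟨by linarith, by linarith⟩)
      (g := fun x => f (x, y)) (h := fun x => pd1 f (x, y))
      (fun t ht => hasDeriv_pd1 (d0 (t, y) ht))
      (fun t ht => by
        have := hasDeriv_pd1 (d1 (t, y) ht)
        rw [h1 _ ht] at this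
        exact this) x hp
  simp only at this ⊢
  rw [this, hA y, hB y]
  ring

lemma backward (f : ℝ × ℝ → ℝ) (a b c : ℝ) (h : ∀ p ∈ strip,
      f p = a * Real.sin p.1 + b * (Real.cos p.1 * Real.cos p.2)
          + c * (Real.cos p.1 * Real.sin p.2)) :
    ContDiffOn ℝ (⊤ : ℕ∞) f strip ∧ ∀ p ∈ strip,
        pd1 (pd1 f) p = -(f p) ∧
        pd1 (pd2 f) p - (-Real.tan p.1) * pd2 f p = 0 ∧
        pd2 (pd2 f) p - (Real.cos p.1 * Real.sin p.1) * pd1 f p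
          = -((Real.cos p.1) ^ 2 * f p) := by
  have q1 : ∀ p ∈ strip, pd1 f p = a * Real.cos p.1 + b * (-Real.sin p.1 * Real.cos p.2)
          + c * (-Real.sin p.1 * Real.sin p.2) := fun p hp =>
    pd1_eq h (by fun_prop) hp
      ((((Real.hasDerivAt_sin p.1).const_mul a).fun_add
        (((Real.hasDerivAt_cos p.1).mul_const (Real.cos p.2)).const_mul b)).fun_add
        (((Real.hasDerivAt_cos p.1).mul_const (Real.sin p.2)).const_mul c))
  have q2 : ∀ p ∈ strip, pd2 f p = b * (Real.cos p.1 * -Real.sin p.2)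
          + c * (Real.cos p.1 * Real.cos p.2) := fun p hp =>
    pd2_eq h (by fun_prop) hp
      ((((Real.hasDerivAt_cos p.2).const_mul (Real.cos p.1)).const_mul b).const_add (a * Real.sin p.1) |>.fun_add
        (((Real.hasDerivAt_sin p.2).const_mul (Real.cos p.1)).const_mul c))
  have q11 : ∀ p ∈ strip, pd1 (pd1 f) p = a * -Real.sin p.1 + b * (-Real.cos p.1 * Real.cos p.2)
          + c * (-Real.cos p.1 * Real.sin p.2) := fun p hp =>
    pd1_eq q1 (by fun_prop) hp
      ((((Real.hasDerivAt_cos p.1).const_mul a).fun_add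
        (((Real.hasDerivAt_sin p.1).fun_neg.mul_const (Real.cos p.2)).const_mul b)).fun_add
        (((Real.hasDerivAt_sin p.1).fun_neg.mul_const (Real.sin p.2)).const_mul c))
  have q12 : ∀ p ∈ strip, pd1 (pd2 f) p = b * (-Real.sin p.1 * -Real.sin p.2)
          + c * (-Real.sin p.1 * Real.cos p.2) := fun p hp =>
    pd1_eq q2 (by fun_prop) hp
      ((((Real.hasDerivAt_cos p.1).mul_const (-Real.sin p.2)).const_mul b).fun_add
        (((Real.hasDerivAt_cos p.1).mul_const (Real.cos p.2)).const_mul c))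
  have q22 : ∀ p ∈ strip, pd2 (pd2 f) p = b * (Real.cos p.1 * -Real.cos p.2)
          + c * (Real.cos p.1 * -Real.sin p.2) := fun p hp =>
    pd2_eq q2 (by fun_prop) hp
      ((((Real.hasDerivAt_sin p.2).fun_neg.const_mul (Real.cos p.1)).const_mul b).fun_add
        (((Real.hasDerivAt_cos p.2).const_mul (Real.cos p.1)).const_mul c))
  refine ⟨?_, fun p hp => ?_⟩
  · refine ContDiffOn.congr (ContDiff.contDiffOn ?_) h
    have s : ContDiff ℝ (⊤ : ℕ∞) Real.sin := Real.contDiff_sin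
    have t : ContDiff ℝ (⊤ : ℕ∞) Real.cos := Real.contDiff_cos
    fun_prop
  · have hc : Real.cos p.1 ≠ 0 := (Real.cos_pos_of_mem_Ioo hp).ne'
    rw [q11 p hp, q12 p hp, q22 p hp, q1 p hp, q2 p hp, h p hp, Real.tan_eq_sin_div_cos]
    refine ⟨by ring, by field_simp; ring, ?_⟩
    linear_combination (-b * Real.cos p.1 * Real.cos p.2 - c * Real.cos p.1 * Real.sin p.2) *
      (-Real.sin_sq_add_cos_sq p.1) 

/-- For the Levi-Civita connection of the round sphere metric
dx¹⊗dx¹ + cos²(x¹)dx²⊗dx² on the strip (−π/2, π/2) × ℝ (Γ₁₂² = −tan x¹,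
Γ₂₂¹ = cos x¹ sin x¹, others zero, ρ_s = dx¹⊗dx¹ + cos²(x¹)dx²⊗dx²), the smooth
solutions of the affine quasi-Einstein equation with μ = −1 are exactly the span of
sin x¹, cos x¹ cos x² and cos x¹ sin x². -/
theorem stmt14 (f : ℝ × ℝ → ℝ) :
    (ContDiffOn ℝ (⊤ : ℕ∞) f {p : ℝ × ℝ | -(Real.pi / 2) < p.1 ∧ p.1 < Real.pi / 2} ∧
      ∀ p : ℝ × ℝ, -(Real.pi / 2) < p.1 → p.1 < Real.pi / 2 →
        pd1 (pd1 f) p = -(f p) ∧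
        pd1 (pd2 f) p - (-Real.tan p.1) * pd2 f p = 0 ∧
        pd2 (pd2 f) p - (Real.cos p.1 * Real.sin p.1) * pd1 f p
          = -((Real.cos p.1) ^ 2 * f p)) ↔
    (∃ a b c : ℝ, ∀ p : ℝ × ℝ, -(Real.pi / 2) < p.1 → p.1 < Real.pi / 2 →
      f p = a * Real.sin p.1 + b * (Real.cos p.1 * Real.cos p.2)
          + c * (Real.cos p.1 * Real.sin p.2)) := by
  constructor
  · rintro ⟨hf, h⟩
    obtain ⟨a, b, c, H⟩ := forward f hf (fun p hp => (h p hp.1 hp.2).1)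
      (fun p hp => (h p hp.1 hp.2).2.1) (fun p hp => (h p hp.1 hp.2).2.2)
    exact ⟨a, b, c, fun p h1 h2 => H p ⟨h1, h2⟩⟩
  · rintro ⟨a, b, c, H⟩
    obtain ⟨h1, h2⟩ := backward f a b c (fun p hp => H p hp.1 hp.2)
    exact ⟨h1, fun p u v => h2 p ⟨u, v⟩⟩
end

section
/- Let ε = ±1. Consider on ℝ² the torsion-free connection with Christoffel symbols Γ_{12}^2 = Γ_{21}^2 = 1, Γ_{22}^1 = −ε·e^{2x¹} and all other Γ_{ij}^k = 0 (the Levi-Civita connection of ε·dx¹⊗dx¹ + e^{2x¹}·dx²⊗dx²; its Ricci tensor is ρ_s = −dx¹⊗dx¹ − ε·e^{2x¹}·dx²⊗dx²). The set of smooth f : ℝ² → ℝ satisfying (Hf)₁₁ = f, (Hf)₁₂ = 0 and (Hf)₂₂ = ε·e^{2x¹}·f (the affine quasi-Einstein equation with μ = −1) is exactly the real span of the three functions e^{x¹}, x²·e^{x¹}, and e^{−x¹} + ε·(x²)²·e^{x¹}. -/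
def HP (f : ℝ × ℝ → ℝ) (a b : ℝ) (p : ℝ × ℝ) : Prop :=
  HasFDerivAt f (a • ContinuousLinearMap.fst ℝ ℝ ℝ + b • ContinuousLinearMap.snd ℝ ℝ ℝ) p

theorem HP.pd1 {f a b p} (h : HP f a b p) : pd1 f p = a := by
  unfold HP at h
  simp [_root_.pd1, h.fderiv]

theorem HP.pd2 {f a b p} (h : HP f a b p) : pd2 f p = b := by
  unfold HP at h
  simp [_root_.pd2, h.fderiv]

theorem HP.of_diff {f : ℝ × ℝ → ℝ} (h : Differentiable ℝ f) (p : ℝ × ℝ) :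
    HP f (_root_.pd1 f p) (_root_.pd2 f p) p := by
  unfold HP
  have := (h p).hasFDerivAt
  convert this using 1
  ext <;> simp [_root_.pd1, _root_.pd2]

theorem HP.congr {f a b a' b' p} (h : HP f a b p) (ha : a = a') (hb : b = b') :
    HP f a' b' p := by
  subst ha hb; exact h

theorem HP.const (c : ℝ) (p) : HP (fun _ => c) 0 0 p := by
  unfold HP
  simpa using hasFDerivAt_const c p

theorem HP.x (p) : HP (fun q => q.1) 1 0 p := by
  unfold HP
  simpa using hasFDerivAt_fst

theorem HP.y (p) : HP (fun q => q.2) 0 1 p := by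
  unfold HP
  simpa using hasFDerivAt_snd

theorem HP.add {f g a b c d p} (h : HP f a b p) (k : HP g c d p) :
    HP (fun q => f q + g q) (a + c) (b + d) p := by
  unfold HP at *
  refine (HasFDerivAt.fun_add h k).congr_fderiv ?_
  ext <;> simp

theorem HP.sub {f g a b c d p} (h : HP f a b p) (k : HP g c d p) :
    HP (fun q => f q - g q) (a - c) (b - d) p := by
  unfold HP at *
  refine (HasFDerivAt.fun_sub h k).congr_fderiv ?_
  ext <;> simp

theorem HP.mul {f g a b c d p} (h : HP f a b p) (k : HP g c d p) :
    HP (fun q => f q * g q) (a * g p + f p * c) (b * g p + f p * d) p := by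
  unfold HP at *
  refine (HasFDerivAt.fun_mul h k).congr_fderiv ?_
  ext <;> simp <;> ring

theorem HP.exp {f a b p} (h : HP f a b p) :
    HP (fun q => Real.exp (f q)) (Real.exp (f p) * a) (Real.exp (f p) * b) p := by
  unfold HP at *
  refine (HasFDerivAt.exp h).congr_fderiv ?_
  ext <;> simp

theorem HP.is_const {G : ℝ × ℝ → ℝ} (h : ∀ p, HP G 0 0 p) : ∃ c, ∀ p, G p = c := by
  refine ⟨G 0, fun p => is_const_of_fderiv_eq_zero (𝕜 := ℝ)
    (fun q => (h q).differentiableAt) (fun q => ?_) p 0⟩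
  have := h q
  unfold HP at this
  rw [this.fderiv]; simp

theorem contDiff_pd {f : ℝ × ℝ → ℝ} (h : ContDiff ℝ (⊤ : ℕ∞) f) (v : ℝ × ℝ) :
    Differentiable ℝ (fun p => fderiv ℝ f p v) := by
  have h1 : ContDiff ℝ 1 (fderiv ℝ f) := (contDiff_infty.1 h 2).fderiv_right (by norm_num)
  exact (h1.clm_apply contDiff_const).differentiable (by simp)

theorem pd_comm {f : ℝ × ℝ → ℝ} (h : ContDiff ℝ (⊤ : ℕ∞) f) (p : ℝ × ℝ) :
    pd2 (pd1 f) p = pd1 (pd2 f) p := by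
  have h1 : ContDiff ℝ 1 (fderiv ℝ f) := (contDiff_infty.1 h 2).fderiv_right (by norm_num)
  have h2 : DifferentiableAt ℝ (fderiv ℝ f) p := h1.differentiable (by simp) p
  have hs : IsSymmSndFDerivAt ℝ f p :=
    (contDiff_infty.1 h 2).contDiffAt.isSymmSndFDerivAt (by simp)
  have e : ∀ v w : ℝ × ℝ, fderiv ℝ (fun q => fderiv ℝ f q v) p w
      = fderiv ℝ (fderiv ℝ f) p w v := by
    intro v w
    rw [fderiv_clm_apply h2 (differentiableAt_const v)]
    simp
  change fderiv ℝ (fun q => fderiv ℝ f q (1,0)) p (0,1)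
    = fderiv ℝ (fun q => fderiv ℝ f q (0,1)) p (1,0)
  rw [e, e]
  exact hs _ _

/-- For the Levi-Civita connection of ε·dx¹⊗dx¹ + e^{2x¹}dx²⊗dx² on ℝ²
(Γ₁₂² = 1, Γ₂₂¹ = −ε e^{2x¹}, others zero, ρ_s = −dx¹⊗dx¹ − ε e^{2x¹}dx²⊗dx²,
ε = ±1), the smooth solutions of the affine quasi-Einstein equation with μ = −1 are
exactly the span of e^{x¹}, x²e^{x¹} and e^{−x¹} + ε(x²)²e^{x¹}. -/
theorem stmt15 (ε : ℝ) (hε : ε = 1 ∨ ε = -1) (f : ℝ × ℝ → ℝ) :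
    (ContDiff ℝ (⊤ : ℕ∞) f ∧
      ∀ p : ℝ × ℝ,
        pd1 (pd1 f) p = f p ∧
        pd1 (pd2 f) p - 1 * pd2 f p = 0 ∧
        pd2 (pd2 f) p - (-ε * Real.exp (2 * p.1)) * pd1 f p
          = ε * Real.exp (2 * p.1) * f p) ↔
    (∃ a b c : ℝ, ∀ p : ℝ × ℝ,
      f p = a * Real.exp p.1 + b * (p.2 * Real.exp p.1)
          + c * (Real.exp (-p.1) + ε * p.2 ^ 2 * Real.exp p.1)) := by
  constructor
  · rintro ⟨hf, H⟩
    have F0 : ∀ p, HP f (pd1 f p) (pd2 f p) p :=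
      HP.of_diff (hf.differentiable (by simp))
    have F1 : ∀ p, HP (pd1 f) (f p) (pd2 f p) p := fun p =>
      (HP.of_diff (contDiff_pd hf (1, 0)) p).congr (H p).1
        ((pd_comm hf p).trans (by linarith [(H p).2.1]))
    have F2 : ∀ p, HP (pd2 f) (pd2 f p)
        (ε * Real.exp (2 * p.1) * (f p - pd1 f p)) p := fun p =>
      (HP.of_diff (contDiff_pd hf (0, 1)) p).congr (by
        have := (H p).2.1
        change pd1 (pd2 f) p = _
        linarith) (by
        have := (H p).2.2
        change pd2 (pd2 f) p = _
        linarith)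
    have EN : ∀ p : ℝ × ℝ, HP (fun q => Real.exp (-1 * q.1)) (-Real.exp (-1 * p.1)) 0 p :=
      fun p => ((HP.const (-1) p).mul (HP.x p)).exp.congr (by ring) (by ring)
    have EP : ∀ p : ℝ × ℝ, Real.exp (-1 * p.1) * Real.exp p.1 = 1 := fun p => by
      rw [← Real.exp_add]; simp
    have E2 : ∀ p : ℝ × ℝ, Real.exp (2 * p.1) = Real.exp p.1 * Real.exp p.1 := fun p => by
      rw [← Real.exp_add]; ring_nf
    obtain ⟨c, hc⟩ := HP.is_const (G := fun q => (f q - pd1 f q) * Real.exp q.1)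
      (fun p => (((F0 p).sub (F1 p)).mul (HP.x p).exp).congr (by ring) (by ring))
    obtain ⟨b, hb⟩ := HP.is_const
      (G := fun q => pd2 f q * Real.exp (-1 * q.1) - (ε * c) * q.2)
      (fun p => (((F2 p).mul (EN p)).sub ((HP.const (ε * c) p).mul (HP.y p))).congr
        (by ring) (by
          have h1 := hc p
          have h2 := EP p
          rw [E2]
          linear_combination ε * Real.exp (-1 * p.1) * Real.exp p.1 * h1 + ε * c * h2))
    obtain ⟨a, ha⟩ := HP.is_const
      (G := fun q => f q * Real.exp (-1 * q.1)
        - (c / 2) * (Real.exp (-1 * q.1) * Real.exp (-1 * q.1))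
        - b * q.2 - (ε * c / 2) * (q.2 * q.2))
      (fun p => (((((F0 p).mul (EN p)).sub ((HP.const (c / 2) p).mul ((EN p).mul (EN p)))).sub
        ((HP.const b p).mul (HP.y p))).sub
          ((HP.const (ε * c / 2) p).mul ((HP.y p).mul (HP.y p)))).congr
        (by
          have h1 := hc p
          have h2 := EP p
          linear_combination -Real.exp (-1 * p.1) ^ 2 * h1
            + (f p - pd1 f p) * Real.exp (-1 * p.1) * h2)
        (by
          have h1 := hb p
          linear_combination h1))
    refine ⟨a, b, c / 2, fun p => ?_⟩
    have h1 := ha p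
    have h2 := EP p
    rw [show -p.1 = -1 * p.1 by ring]
    linear_combination Real.exp p.1 * h1 - (f p - c / 2 * Real.exp (-1 * p.1)) * h2
  · rintro ⟨a, b, c, h⟩
    have hf : f = fun p => a * Real.exp p.1 + b * (p.2 * Real.exp p.1)
          + c * (Real.exp (-1 * p.1) + ε * (p.2 * p.2) * Real.exp p.1) := by
      funext p; rw [h p, neg_one_mul]; ring
    have EN : ∀ p : ℝ × ℝ, HP (fun q => Real.exp (-1 * q.1)) (-Real.exp (-1 * p.1)) 0 p :=
      fun p => ((HP.const (-1) p).mul (HP.x p)).exp.congr (by ring) (by ring)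
    have EX : ∀ p : ℝ × ℝ, HP (fun q => Real.exp q.1) (Real.exp p.1) 0 p :=
      fun p => (HP.x p).exp.congr (by ring) (by ring)
    have EP : ∀ p : ℝ × ℝ, Real.exp (-1 * p.1) * Real.exp p.1 = 1 := fun p => by
      rw [← Real.exp_add]; simp
    have E2 : ∀ p : ℝ × ℝ, Real.exp (2 * p.1) = Real.exp p.1 * Real.exp p.1 := fun p => by
      rw [← Real.exp_add]; ring_nf
    have gen : ∀ (c' : ℝ) (p : ℝ × ℝ), HP (fun p => a * Real.exp p.1 + b * (p.2 * Real.exp p.1)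
          + (c' * Real.exp (-1 * p.1) + c * (ε * (p.2 * p.2) * Real.exp p.1)))
        (a * Real.exp p.1 + b * (p.2 * Real.exp p.1)
          + (-c' * Real.exp (-1 * p.1) + c * (ε * (p.2 * p.2) * Real.exp p.1)))
        ((b + 2 * c * ε * p.2) * Real.exp p.1) p := fun c' p =>
      ((((HP.const a p).mul (EX p)).add ((HP.const b p).mul ((HP.y p).mul (EX p)))).add
        (((HP.const c' p).mul (EN p)).add ((HP.const c p).mul
          (((HP.const ε p).mul ((HP.y p).mul (HP.y p))).mul (EX p))))).congr
        (by ring) (by ring)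
    have hf' : f = fun p => a * Real.exp p.1 + b * (p.2 * Real.exp p.1)
          + (c * Real.exp (-1 * p.1) + c * (ε * (p.2 * p.2) * Real.exp p.1)) := by
      rw [hf]; funext p; ring
    have e1 : pd1 f = fun p => a * Real.exp p.1 + b * (p.2 * Real.exp p.1)
          + (-c * Real.exp (-1 * p.1) + c * (ε * (p.2 * p.2) * Real.exp p.1)) := by
      funext p; rw [hf']; exact (gen c p).pd1
    have e2 : pd2 f = fun p => (b + 2 * c * ε * p.2) * Real.exp p.1 := by
      funext p; rw [hf']; exact (gen c p).pd2
    have D2 : ∀ p : ℝ × ℝ, HP (fun p => (b + 2 * c * ε * p.2) * Real.exp p.1)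
        ((b + 2 * c * ε * p.2) * Real.exp p.1) (2 * c * ε * Real.exp p.1) p := fun p =>
      (((HP.const b p).add ((HP.const (2 * c * ε) p).mul (HP.y p))).mul (EX p)).congr
        (by ring) (by ring)
    refine ⟨by rw [hf]; fun_prop, fun p => ⟨?_, ?_, ?_⟩⟩
    · rw [e1, (gen (-c) p).pd1, hf']; ring
    · rw [e2, (D2 p).pd1]; ring
    · rw [e2, (D2 p).pd2, e1, hf', E2]
      linear_combination -2 * c * ε * Real.exp p.1 * EP p
end
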